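/- Let (Γ, π, B) be a binary radix system. Then there exists an admissible non-null pair (α,β) such that B = B_{(α,β)} and either Γ = Ω^•_{(α,β,−)} or Γ = Ω^•_{(α,β,+)}. -/

import Mathlib

open scoped Classical

/-- Infinite binary strings. -/
abbrev Omega : Type := ℕ → Bool

/-- The shift operator. -/
def shift (ω : Omega) : Omega := fun n => ω (n + 1)

/-- Strict lexicographic order on `Omega`. -/
def lexLt (σ ω : Omega) : Prop :=
  ∃ k : ℕ, (∀ i, i < k → σ i = ω i) ∧ σ k < ω k

/-- Non-strict lexicographic order on `Omega`. -/
def lexLe (σ ω : Omega) : Prop := lexLt σ ω ∨ σ = ω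

/-- An admissible pair of strings. -/
def Admissible (α β : Omega) : Prop :=
  α 0 = false ∧ α 1 = true ∧ β 0 = true ∧ β 1 = false ∧
  (∀ n : ℕ, ¬ (lexLt α (shift^[n] α) ∧ lexLe (shift^[n] α) β)) ∧
  (∀ n : ℕ, ¬ (lexLe α (shift^[n] β) ∧ lexLt (shift^[n] β) β))

/-- The address space `Ω_{(α,β,−)}`. -/
def OmegaMinus (α β : Omega) : Set Omega :=
  {ω | ∀ n : ℕ, ¬ (lexLt α (shift^[n] ω) ∧ lexLe (shift^[n] ω) β)}

/-- The address space `Ω_{(α,β,+)}`. -/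
def OmegaPlus (α β : Omega) : Set Omega :=
  {ω | ∀ n : ℕ, ¬ (lexLe α (shift^[n] ω) ∧ lexLt (shift^[n] ω) β)}

/-- The address space `Ω_{(α,β)}`. -/
def OmegaUnion (α β : Omega) : Set Omega := OmegaMinus α β ∪ OmegaPlus α β

/-- Length-`n` initial segments of the elements of `Γ`. -/
def initSegs (Γ : Set Omega) (n : ℕ) : Set (Fin n → Bool) :=
  (fun ω (i : Fin n) => ω i) '' Γ

/-- Exponential growth rate `h(Γ)`. -/
noncomputable def growth (Γ : Set Omega) : ℝ :=
  Filter.limsup (fun n : ℕ => Real.log ((initSegs Γ n).ncard) / (n : ℝ)) Filter.atTop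

/-- The projection map `π_x`. -/
noncomputable def proj (x : ℝ) (ω : Omega) : ℝ :=
  (1 - x) * ∑' k : ℕ, (if ω k then (1 : ℝ) else 0) * x ^ k

/-- The equation `Σ α_n x^n = Σ β_n x^n`. -/
def seriesEq (α β : Omega) (x : ℝ) : Prop :=
  (∑' n : ℕ, (if α n then (1 : ℝ) else 0) * x ^ n) =
    (∑' n : ℕ, (if β n then (1 : ℝ) else 0) * x ^ n)

/-- Solutions in `[1/2,1)` of `Σ α_n x^n = Σ β_n x^n`. -/
def baseSet (α β : Omega) : Set ℝ :=
  {x : ℝ | x ∈ Set.Ico (1/2 : ℝ) 1 ∧ seriesEq α β x}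

/-- A decimal: a two-sided binary string vanishing far to the left. -/
def IsDecimal (d : ℤ → Bool) : Prop := ∃ m : ℤ, ∀ j, j < m → d j = false

/-- Strict order on decimals. -/
def decLt (d e : ℤ → Bool) : Prop :=
  ∃ j : ℤ, (∀ i, i < j → d i = e i) ∧ d j < e j

/-- The set `Γ^•` of decimals obtained from strings in `Γ`. -/
def dot (Γ : Set Omega) : Set (ℤ → Bool) :=
  {d | ∃ m : ℤ, ∃ γ ∈ Γ, (∀ j, j < m → d j = false) ∧ ∀ i : ℕ, d (m + i) = γ i}

/-- Prepend a `0` to a string. -/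
def cons0 (ω : Omega) : Omega := fun n => match n with | 0 => false | k + 1 => ω k

/-- The space `Ω⁰_{(α,β,−)}`. -/
def Omega0Minus (α β : Omega) : Set Omega :=
  {ω ∈ OmegaMinus α β | lexLe (cons0 ω) α}

/-- The space `Ω⁰_{(α,β,+)}`. -/
def Omega0Plus (α β : Omega) : Set Omega :=
  {ω ∈ OmegaPlus α β | lexLt (cons0 ω) α}

/-- The address space of decimals `Ω^•_{(α,β,−)}`. -/
def dotMinus (α β : Omega) : Set (ℤ → Bool) := dot (Omega0Minus α β)

/-- The address space of decimals `Ω^•_{(α,β,+)}`. -/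
def dotPlus (α β : Omega) : Set (ℤ → Bool) := dot (Omega0Plus α β)

/-- The address space of decimals `Ω^•_{(α,β)}`. -/
def dotUnion (α β : Omega) : Set (ℤ → Bool) :=
  dot (Omega0Minus α β ∪ Omega0Plus α β)

/-- The radix map `d ↦ Σ_{j ∈ ℤ} d(j)·B^(−j)`. -/
noncomputable def radixVal (B : ℝ) (d : ℤ → Bool) : ℝ :=
  ∑' j : ℤ, (if d j then (1 : ℝ) else 0) * B ^ (-j)

/-- Shift invariance for a set of decimals. -/
def ShiftInvariantDec (Γ : Set (ℤ → Bool)) : Prop :=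
  ∀ d ∈ Γ, ∀ k m : ℤ,
    (fun j : ℤ => if m ≤ j then d (j + k) else false) ∈ Γ

/-- A binary radix system `(Γ, π, B)`: `B > 1`, `Γ` a shift-invariant set of decimals,
and the radix map `d ↦ Σ_j d(j)·B^(−j)` is a strictly increasing bijection from `Γ`
onto `[0,∞)`. -/
structure BinaryRadixSystem where
  Γ : Set (ℤ → Bool)
  B : ℝ
  hB : 1 < B
  hdec : ∀ d ∈ Γ, IsDecimal d
  hshift : ShiftInvariantDec Γ
  hmono : ∀ d ∈ Γ, ∀ e ∈ Γ, decLt d e → radixVal B d < radixVal B e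
  hbij : Set.BijOn (radixVal B) Γ (Set.Ici (0 : ℝ))

/-! ### Lexicographic order -/

lemma lexLe_iff_toLex {u v : Omega} : lexLe u v ↔ toLex u ≤ toLex v := by
  rw [le_iff_lt_or_eq]; exact Iff.rfl

lemma not_lexLt {u v : Omega} : ¬ lexLt u v ↔ lexLe v u := by
  rw [lexLe_iff_toLex]
  exact not_lt (a := toLex u)

lemma not_lexLe {u v : Omega} : ¬ lexLe u v ↔ lexLt v u := by
  rw [lexLe_iff_toLex]
  exact not_le (a := toLex u)

lemma lexLt_or_lexLt_of_ne {u v : Omega} (h : u ≠ v) : lexLt u v ∨ lexLt v u :=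
  lt_or_gt_of_ne (show toLex u ≠ toLex v from h)

lemma lexLt_irrefl (u : Omega) : ¬ lexLt u u := lt_irrefl (toLex u)

lemma lexLt_of_lexLe_of_lexLt {u v w : Omega} (h : lexLe u v) (h' : lexLt v w) : lexLt u w := by
  rw [lexLe_iff_toLex] at h
  exact lt_of_le_of_lt h h'

lemma lexLt_iff_exists {u v : Omega} :
    lexLt u v ↔ ∃ k, (∀ i, i < k → u i = v i) ∧ u k = false ∧ v k = true := by
  simp only [lexLt, Bool.lt_iff]

lemma lexLt_of_head {u v : Omega} (hu : u 0 = false) (hv : v 0 = true) : lexLt u v :=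
  lexLt_iff_exists.2 ⟨0, by simp, hu, hv⟩

/-! ### Shifts -/

lemma shift_iterate_apply (n i : ℕ) (u : Omega) : shift^[n] u i = u (n + i) := by
  induction n generalizing u with
  | zero => simp
  | succ n ih => rw [Function.iterate_succ_apply, ih, shift]; congr 1; omega

lemma shift_iterate_zero (n : ℕ) (u : Omega) : shift^[n] u 0 = u n :=
  shift_iterate_apply n 0 u

lemma lexLt_shift_iterate {u v : Omega} {n : ℕ} (huv : ∀ i < n, u i = v i) (h : lexLt u v) :
    lexLt (shift^[n] u) (shift^[n] v) := by
  obtain ⟨k, hk, h0, h1⟩ := lexLt_iff_exists.1 h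
  have hnk : n ≤ k := by
    by_contra! hlt
    have := huv k hlt
    simp_all
  refine lexLt_iff_exists.2 ⟨k - n, fun i hi => ?_, ?_, ?_⟩
  · simpa only [shift_iterate_apply] using hk _ (by omega)
  · rwa [shift_iterate_apply, Nat.add_sub_cancel' hnk]
  · rwa [shift_iterate_apply, Nat.add_sub_cancel' hnk]

/-! ### Complementation -/

/-- Exchange the two digits. -/
def flipDigits (u : Omega) : Omega := fun n => !(u n)

@[simp] lemma flipDigits_flipDigits (u : Omega) : flipDigits (flipDigits u) = u := by
  funext n; simp [flipDigits]

@[simp] lemma flipDigits_apply (u : Omega) (n : ℕ) : flipDigits u n = !(u n) := rfl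

lemma shift_iterate_flipDigits (n : ℕ) (u : Omega) :
    shift^[n] (flipDigits u) = flipDigits (shift^[n] u) := by
  funext i; simp [shift_iterate_apply]

lemma lexLt_flipDigits {u v : Omega} : lexLt (flipDigits u) (flipDigits v) ↔ lexLt v u := by
  simp only [lexLt_iff_exists, flipDigits_apply, Bool.not_eq_false', Bool.not_eq_true',
    Bool.not_inj_iff]
  exact exists_congr fun k => and_congr (forall₂_congr fun i _ => eq_comm) and_comm

lemma lexLe_flipDigits {u v : Omega} : lexLe (flipDigits u) (flipDigits v) ↔ lexLe v u := by
  rw [← not_lexLt, ← not_lexLt, lexLt_flipDigits]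

/-! ### Values of strings -/

/-- The value `∑ uₙ xⁿ` of a binary string. -/
noncomputable def val (x : ℝ) (u : Omega) : ℝ :=
  ∑' n : ℕ, (if u n then (1 : ℝ) else 0) * x ^ n

section Val

variable {x : ℝ}

lemma summable_val (h0 : 0 ≤ x) (h1 : x < 1) (u : Omega) :
    Summable fun n : ℕ => (if u n then (1 : ℝ) else 0) * x ^ n := by
  refine Summable.of_nonneg_of_le (fun n => ?_) (fun n => ?_) (summable_geometric_of_lt_one h0 h1)
  · split_ifs <;> positivity
  · have := pow_nonneg h0 n
    split_ifs <;> simp [this]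

lemma val_nonneg (h0 : 0 ≤ x) (u : Omega) : 0 ≤ val x u :=
  tsum_nonneg fun n => by split_ifs <;> positivity

lemma val_flipDigits (h0 : 0 ≤ x) (h1 : x < 1) (u : Omega) :
    val x (flipDigits u) = (1 - x)⁻¹ - val x u := by
  rw [eq_sub_iff_add_eq, ← tsum_geometric_of_lt_one h0 h1, val, val,
    ← (summable_val h0 h1 _).tsum_add (summable_val h0 h1 _)]
  congr 1 with n
  cases h : u n <;> simp [h]

lemma val_le (h0 : 0 ≤ x) (h1 : x < 1) (u : Omega) : val x u ≤ (1 - x)⁻¹ := by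
  linarith [val_nonneg h0 (flipDigits u), val_flipDigits h0 h1 u]

lemma val_eq_add_shift (h0 : 0 ≤ x) (h1 : x < 1) (u : Omega) :
    val x u = (if u 0 then 1 else 0) + x * val x (shift u) := by
  rw [val, (summable_val h0 h1 u).tsum_eq_zero_add, val, ← tsum_mul_left]
  simp only [pow_zero, mul_one]
  congr 1
  refine tsum_congr fun n => ?_
  change _ = x * ((if u (n + 1) then (1 : ℝ) else 0) * x ^ n)
  ring

lemma val_of_head_false (h0 : 0 ≤ x) (h1 : x < 1) {u : Omega} (hu : u 0 = false) :
    val x u = x * val x (shift u) := by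
  simp [val_eq_add_shift h0 h1 u, hu]

lemma one_le_val (h0 : 0 ≤ x) (h1 : x < 1) {u : Omega} (hu : u 0 = true) : 1 ≤ val x u := by
  rw [val_eq_add_shift h0 h1 u, if_pos hu]
  linarith [mul_nonneg h0 (val_nonneg h0 (shift u))]

lemma val_cons0 (h0 : 0 ≤ x) (h1 : x < 1) (u : Omega) : val x (cons0 u) = x * val x u :=
  val_of_head_false h0 h1 rfl

lemma val_sub_val_of_agree (h0 : 0 ≤ x) (h1 : x < 1) {u v : Omega} {n : ℕ}
    (h : ∀ i < n, u i = v i) :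
    val x u - val x v = x ^ n * (val x (shift^[n] u) - val x (shift^[n] v)) := by
  induction n generalizing u v with
  | zero => simp
  | succ n ih =>
    have := ih (u := shift u) (v := shift v) fun i hi => h (i + 1) (by omega)
    rw [val_eq_add_shift h0 h1 u, val_eq_add_shift h0 h1 v, h 0 (by omega),
      Function.iterate_succ_apply, Function.iterate_succ_apply, pow_succ]
    linear_combination x * this

lemma abs_val_sub_val_le (h0 : 0 ≤ x) (h1 : x < 1) (u v : Omega) :
    |val x u - val x v| ≤ (1 - x)⁻¹ := by
  rw [abs_le]
  constructor <;> linarith [val_le h0 h1 u, val_le h0 h1 v, val_nonneg h0 u, val_nonneg h0 v]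

lemma abs_val_sub_val_le_of_agree (h0 : 0 ≤ x) (h1 : x < 1) {u v : Omega} {n : ℕ}
    (h : ∀ i < n, u i = v i) : |val x u - val x v| ≤ x ^ n * (1 - x)⁻¹ := by
  rw [val_sub_val_of_agree h0 h1 h, abs_mul, abs_of_nonneg (pow_nonneg h0 n)]
  exact mul_le_mul_of_nonneg_left (abs_val_sub_val_le h0 h1 _ _) (pow_nonneg h0 n)

end Val

/-! ### Lexicographic suprema -/

/-- Among the strings of `W`, keep those that are lexicographically largest on the first `n`
digits. -/
def maxPrefixSet (W : Set Omega) : ℕ → Set Omega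
  | 0 => W
  | n + 1 => {u ∈ maxPrefixSet W n | (∃ v ∈ maxPrefixSet W n, v n = true) → u n = true}

/-- `α` is the lexicographic supremum of `W`, approximated by elements of `W`. -/
structure IsLexSup (W : Set Omega) (α : Omega) : Prop where
  le : ∀ u ∈ W, lexLe u α
  approx : ∀ n, ∃ u ∈ W, ∀ i < n, u i = α i

lemma exists_isLexSup {W : Set Omega} (hW : W.Nonempty) : ∃ α, IsLexSup W α := by
  set P := maxPrefixSet W with hP
  set α : Omega := fun n => decide (∃ v ∈ P n, v n = true) with hα
  have hanti : ∀ n, P (n + 1) ⊆ P n := fun n u hu => hu.1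
  have hne : ∀ n, (P n).Nonempty := by
    intro n
    induction n with
    | zero => exact hW
    | succ n ih =>
      by_cases h : ∃ v ∈ P n, v n = true
      · obtain ⟨v, hv, hvn⟩ := h
        exact ⟨v, hv, fun _ => hvn⟩
      · obtain ⟨v, hv⟩ := ih
        exact ⟨v, hv, fun h' => absurd h' h⟩
  have hstep : ∀ n, ∀ u ∈ P (n + 1), u n = α n := by
    intro n u hu
    by_cases h : ∃ v ∈ P n, v n = true
    · rw [hu.2 h]; simpa [hα] using h
    · have : u n ≠ true := fun hn => h ⟨u, hu.1, hn⟩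
      have h2 : α n = false := by simpa [hα] using h
      rw [h2]; simpa using this
  have hagree : ∀ n, ∀ u ∈ P n, ∀ i < n, u i = α i := by
    intro n
    induction n with
    | zero => simp
    | succ n ih =>
      intro u hu i hi
      rcases Nat.lt_succ_iff_lt_or_eq.1 hi with h | rfl
      · exact ih u hu.1 i h
      · exact hstep _ u hu
  have hsub : ∀ n, P n ⊆ W := by
    intro n
    induction n with
    | zero => exact subset_rfl
    | succ n ih => exact (hanti n).trans ih
  refine ⟨α, fun u hu => ?_, fun n => ?_⟩
  · by_cases hall : ∀ n, u ∈ P n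
    · exact Or.inr (funext fun n => hstep n u (hall (n + 1)))
    · push Not at hall
      classical
      have hmin := Nat.find_spec hall
      obtain ⟨m, hm⟩ : ∃ m, Nat.find hall = m + 1 :=
        Nat.exists_eq_succ_of_ne_zero fun h0 => by rw [h0] at hmin; exact hmin hu
      have hmem : u ∈ P m := by
        by_contra hc
        have := Nat.find_min' hall hc
        omega
      rw [hm] at hmin
      have : ¬ ((∃ v ∈ P m, v m = true) → u m = true) := fun h => hmin ⟨hmem, h⟩
      push Not at this
      refine Or.inl (lexLt_iff_exists.2 ⟨m, hagree m u hmem, by simpa using this.2, ?_⟩)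
      simpa [hα] using this.1
  · obtain ⟨u, hu⟩ := hne n
    exact ⟨u, hsub n hu, hagree n u hu⟩

namespace IsLexSup

variable {W : Set Omega} {α : Omega} {b : ℝ}

lemma exists_gt (h : IsLexSup W α) {u : Omega} (hu : lexLt u α) : ∃ v ∈ W, lexLt u v := by
  obtain ⟨k, hk, h0, h1⟩ := lexLt_iff_exists.1 hu
  obtain ⟨v, hv, hva⟩ := h.approx (k + 1)
  refine ⟨v, hv, lexLt_iff_exists.2 ⟨k, fun i hi => ?_, h0, ?_⟩⟩
  · rw [hk i hi, hva i (by omega)]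
  · rw [hva k (by omega), h1]

lemma val_le_of_forall_val_le (h : IsLexSup W α) (h0 : 0 ≤ b) (h1 : b < 1) {c : ℝ}
    (hc : ∀ u ∈ W, val b u ≤ c) : val b α ≤ c := by
  have hlim : Filter.Tendsto (fun n : ℕ => c + b ^ n * (1 - b)⁻¹) Filter.atTop (nhds c) := by
    simpa using ((tendsto_pow_atTop_nhds_zero_of_lt_one h0 h1).mul_const (1 - b)⁻¹).const_add c
  refine ge_of_tendsto' hlim fun n => ?_
  obtain ⟨u, hu, hn⟩ := h.approx n
  have := abs_le.1 (abs_val_sub_val_le_of_agree h0 h1 hn)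
  linarith [hc u hu]

lemma val_le (h : IsLexSup W α) (h0 : 0 ≤ b) (h1 : b < 1)
    (hmono : ∀ u ∈ W, ∀ v ∈ W, lexLt u v → val b u < val b v) {u : Omega} (hu : u ∈ W) :
    val b u ≤ val b α := by
  rcases h.le u hu with hlt | rfl
  · obtain ⟨k, hk, hu0, hα1⟩ := lexLt_iff_exists.1 hlt
    have hlim : Filter.Tendsto (fun n : ℕ => val b α + b ^ n * (1 - b)⁻¹) Filter.atTop
        (nhds (val b α)) := by
      simpa using ((tendsto_pow_atTop_nhds_zero_of_lt_one h0 h1).mul_const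
        (1 - b)⁻¹).const_add (val b α)
    refine ge_of_tendsto hlim (Filter.eventually_atTop.2 ⟨k + 1, fun n hn => ?_⟩)
    obtain ⟨v, hv, hva⟩ := h.approx n
    have huv : lexLt u v := lexLt_iff_exists.2
      ⟨k, fun i hi => by rw [hk i hi, hva i (by omega)], hu0, by rw [hva k (by omega), hα1]⟩
    have := abs_le.1 (abs_val_sub_val_le_of_agree h0 h1 hva)
    linarith [hmono u hu v hv huv]
  · exact le_rfl

end IsLexSup

/-! ### Systems of strings with a critical value -/

/-- A shift-invariant set `W` of strings on which `val b` is strictly increasing, together with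
the lexicographic supremum `α` of its strings starting with `0` and the lexicographic infimum `β`
of its strings starting with `1`, both of value `c`, exactly one of which is in `W`. -/
structure CriticalSystem (W : Set Omega) (b c : ℝ) (α β : Omega) : Prop where
  pos : 0 < b
  lt_one : b < 1
  shift_mem : ∀ u ∈ W, shift u ∈ W
  mono : ∀ u ∈ W, ∀ v ∈ W, lexLt u v → val b u < val b v
  isLexSup : IsLexSup {u ∈ W | u 0 = false} α
  isLexInf : IsLexSup {u | flipDigits u ∈ W ∧ u 0 = false} (flipDigits β)
  val_left : val b α = c
  val_right : val b β = c
  mem_iff : α ∈ W ↔ β ∉ W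

/-- The strings all of whose shifts are, according to their first digit, at most `α` or at
least `β`. -/
def coreSet (α β : Omega) : Set Omega :=
  {ω | ∀ n, (ω n = false → lexLe (shift^[n] ω) α) ∧ (ω n = true → lexLe β (shift^[n] ω))}

lemma shift_iterate_mem_coreSet {α β ω : Omega} (h : ω ∈ coreSet α β) (n : ℕ) :
    shift^[n] ω ∈ coreSet α β := by
  intro m
  have := h (n + m)
  rwa [shift_iterate_apply, ← Function.iterate_add_apply, Nat.add_comm m n]

lemma flipDigits_mem_coreSet {α β ω : Omega} (h : ω ∈ coreSet α β) :
    flipDigits ω ∈ coreSet (flipDigits β) (flipDigits α) := by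
  intro n
  simp only [shift_iterate_flipDigits, lexLe_flipDigits, flipDigits_apply,
    Bool.not_eq_false', Bool.not_eq_true']
  exact (h n).symm

namespace CriticalSystem

variable {W : Set Omega} {b c : ℝ} {α β : Omega}

lemma flip (h : CriticalSystem W b c α β) :
    CriticalSystem {u | flipDigits u ∈ W} b ((1 - b)⁻¹ - c) (flipDigits β) (flipDigits α) where
  pos := h.pos
  lt_one := h.lt_one
  shift_mem u hu := by
    have := h.shift_mem _ hu
    rwa [show shift (flipDigits u) = flipDigits (shift u) from rfl] at this
  mono u hu v hv huv := by
    have := h.mono _ hv _ hu (lexLt_flipDigits.2 huv)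
    rw [val_flipDigits h.pos.le h.lt_one, val_flipDigits h.pos.le h.lt_one] at this
    linarith
  isLexSup := h.isLexInf
  isLexInf := by simpa using h.isLexSup
  val_left := by rw [val_flipDigits h.pos.le h.lt_one, h.val_right]
  val_right := by rw [val_flipDigits h.pos.le h.lt_one, h.val_left]
  mem_iff := by
    have := h.mem_iff
    simp only [Set.mem_ofPred_eq, flipDigits_flipDigits]
    tauto

lemma shift_iterate_mem (h : CriticalSystem W b c α β) {u : Omega} (hu : u ∈ W) (n : ℕ) :
    shift^[n] u ∈ W := by
  induction n generalizing u with
  | zero => exact hu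
  | succ n ih => exact ih (h.shift_mem u hu)

lemma le_left (h : CriticalSystem W b c α β) {u : Omega} (hu : u ∈ W) (h0 : u 0 = false) :
    lexLe u α :=
  h.isLexSup.le u ⟨hu, h0⟩

lemma right_le (h : CriticalSystem W b c α β) {u : Omega} (hu : u ∈ W) (h1 : u 0 = true) :
    lexLe β u := by
  have := h.flip.le_left (u := flipDigits u) (by simpa using hu) (by simpa using h1)
  rwa [lexLe_flipDigits] at this

lemma mem_coreSet (h : CriticalSystem W b c α β) {u : Omega} (hu : u ∈ W) : u ∈ coreSet α β :=
  fun n => ⟨fun hn => h.le_left (h.shift_iterate_mem hu n) (by rwa [shift_iterate_zero]),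
    fun hn => h.right_le (h.shift_iterate_mem hu n) (by rwa [shift_iterate_zero])⟩

lemma val_le (h : CriticalSystem W b c α β) {u : Omega} (hu : u ∈ W) (h0 : u 0 = false) :
    val b u ≤ c := by
  rw [← h.val_left]
  exact h.isLexSup.val_le h.pos.le h.lt_one (fun u hu v hv => h.mono u hu.1 v hv.1) ⟨hu, h0⟩

lemma le_val (h : CriticalSystem W b c α β) {u : Omega} (hu : u ∈ W) (h1 : u 0 = true) :
    c ≤ val b u := by
  have := h.flip.val_le (u := flipDigits u) (by simpa using hu) (by simpa using h1)
  rw [val_flipDigits h.pos.le h.lt_one] at this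
  linarith

lemma left_zero (h : CriticalSystem W b c α β) : α 0 = false := by
  obtain ⟨u, hu, hn⟩ := h.isLexSup.approx 1
  rw [← hn 0 one_pos, hu.2]

lemma right_zero (h : CriticalSystem W b c α β) : β 0 = true := by
  simpa using h.flip.left_zero

lemma shift_left_le (h : CriticalSystem W b c α β) {n : ℕ} (hn : α n = false) :
    lexLe (shift^[n] α) α := by
  rw [← not_lexLt]
  intro hlt
  obtain ⟨k, hk, h0, h1⟩ := lexLt_iff_exists.1 hlt
  obtain ⟨u, ⟨huW, -⟩, hu⟩ := h.isLexSup.approx (n + k + 1)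
  have hle := h.le_left (h.shift_iterate_mem huW n)
    (by rw [shift_iterate_zero, hu n (by omega), hn])
  refine not_lexLt.2 hle (lexLt_iff_exists.2 ⟨k, fun i hi => ?_, h0, ?_⟩)
  · rw [hk i hi, shift_iterate_apply, shift_iterate_apply, hu _ (by omega)]
  · rw [shift_iterate_apply] at h1 ⊢
    rw [hu _ (by omega), h1]

lemma right_lt_shift_left (h : CriticalSystem W b c α β) {n : ℕ} (hn : α n = true) :
    lexLt β (shift^[n] α) := by
  by_cases hα : α ∈ W
  · have hmem := h.shift_iterate_mem hα n
    rcases h.right_le hmem (by rwa [shift_iterate_zero]) with hlt | heq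
    · exact hlt
    · exact absurd (heq ▸ hmem) (h.mem_iff.1 hα)
  · obtain ⟨u, hu, hua⟩ := h.isLexSup.approx (n + 1)
    have hlt : lexLt u α := (h.isLexSup.le u hu).resolve_right fun he => hα (he ▸ hu.1)
    exact lexLt_of_lexLe_of_lexLt
      (h.right_le (h.shift_iterate_mem hu.1 n) (by rw [shift_iterate_zero, hua n (by omega), hn]))
      (lexLt_shift_iterate (fun i hi => hua i (by omega)) hlt)

lemma lt_val_shift_left (h : CriticalSystem W b c α β) {n : ℕ} (hn : α n = true) :
    c < val b (shift^[n] α) := by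
  by_cases hα : α ∈ W
  · rw [← h.val_left]
    exact h.mono _ hα _ (h.shift_iterate_mem hα n)
      (lexLt_of_head h.left_zero (by rwa [shift_iterate_zero]))
  · obtain ⟨u, hu, hua⟩ := h.isLexSup.approx (n + 1)
    have hlt : lexLt u α := (h.isLexSup.le u hu).resolve_right fun he => hα (he ▸ hu.1)
    obtain ⟨v, hv, huv⟩ := h.isLexSup.exists_gt hlt
    have h1 := h.mono u hu.1 v hv.1 huv
    have h2 := h.val_le hv.1 hv.2
    have h3 := h.le_val (h.shift_iterate_mem hu.1 n)
      (by rw [shift_iterate_zero, hua n (by omega), hn])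
    have h4 := val_sub_val_of_agree h.pos.le h.lt_one (u := α) (v := u) (n := n)
      fun i hi => (hua i (by omega)).symm
    rw [h.val_left] at h4
    have h5 : 0 < val b (shift^[n] α) - val b (shift^[n] u) := by
      by_contra! hc
      have := mul_nonpos_of_nonneg_of_nonpos (pow_nonneg h.pos.le n) hc
      linarith
    linarith

lemma left_mem_coreSet (h : CriticalSystem W b c α β) : α ∈ coreSet α β :=
  fun _ => ⟨h.shift_left_le, fun hn => Or.inl (h.right_lt_shift_left hn)⟩

lemma right_mem_coreSet (h : CriticalSystem W b c α β) : β ∈ coreSet α β := by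
  simpa using flipDigits_mem_coreSet h.flip.left_mem_coreSet

lemma right_le_shift_right (h : CriticalSystem W b c α β) {n : ℕ} (hn : β n = true) :
    lexLe β (shift^[n] β) :=
  (h.right_mem_coreSet n).2 hn

lemma shift_right_lt_left (h : CriticalSystem W b c α β) {n : ℕ} (hn : β n = false) :
    lexLt (shift^[n] β) α := by
  have := h.flip.right_lt_shift_left (n := n) (by simpa using hn)
  rwa [shift_iterate_flipDigits, lexLt_flipDigits] at this

lemma admissible (h : CriticalSystem W b c α β) (hα : α 1 = true) (hβ : β 1 = false) :
    Admissible α β := by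
  refine ⟨h.left_zero, hα, h.right_zero, hβ, fun n => ?_, fun n => ?_⟩
  · rintro ⟨h1, h2⟩
    cases hn : α n with
    | false => exact not_lexLt.2 (h.shift_left_le hn) h1
    | true => exact not_lexLe.2 (h.right_lt_shift_left hn) h2
  · rintro ⟨h1, h2⟩
    cases hn : β n with
    | false => exact not_lexLe.2 (h.shift_right_lt_left hn) h1
    | true => exact not_lexLt.2 (h.right_le_shift_right hn) h2

lemma core_val_le (h : CriticalSystem W b c α β) {ω : Omega} (hω : ω ∈ coreSet α β)
    (h0 : ω 0 = false) : val b ω ≤ c := by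
  have key : ∀ j : ℕ, ∀ ω ∈ coreSet α β, ω 0 = false → val b ω - c ≤ b ^ j * (1 - b)⁻¹ := by
    have hnn : (0 : ℝ) ≤ (1 - b)⁻¹ := inv_nonneg.2 (by linarith [h.lt_one])
    intro j
    induction j with
    | zero =>
      intro ω _ _
      have := abs_le.1 (abs_val_sub_val_le h.pos.le h.lt_one ω α)
      rw [h.val_left] at this
      linarith
    | succ j ih =>
      intro ω hω h0
      have hz : 0 ≤ b ^ j * (1 - b)⁻¹ := mul_nonneg (pow_nonneg h.pos.le j) hnn
      rcases (hω 0).1 h0 with hlt | heq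
      · obtain ⟨k, hk, hk0, hk1⟩ := lexLt_iff_exists.1 hlt
        have hkne : k ≠ 0 := fun hk' => by
          rw [hk', h.left_zero] at hk1
          simp at hk1
        have h4 := val_sub_val_of_agree h.pos.le h.lt_one hk
        have h5 := ih _ (shift_iterate_mem_coreSet hω k) (by rw [shift_iterate_zero]; exact hk0)
        have h6 := h.lt_val_shift_left hk1
        simp only [Function.iterate_zero, id] at h4
        rw [h.val_left] at h4
        rw [h4]
        calc b ^ k * (val b (shift^[k] ω) - val b (shift^[k] α))
            ≤ b ^ k * (b ^ j * (1 - b)⁻¹) := by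
              refine mul_le_mul_of_nonneg_left ?_ (pow_nonneg h.pos.le k)
              linarith
          _ ≤ b * (b ^ j * (1 - b)⁻¹) :=
              mul_le_mul_of_nonneg_right (pow_le_of_le_one h.pos.le h.lt_one.le hkne) hz
          _ = b ^ (j + 1) * (1 - b)⁻¹ := by ring
      · simp only [Function.iterate_zero, id] at heq
        rw [heq, h.val_left, sub_self]
        exact mul_nonneg (pow_nonneg h.pos.le _) hnn
  have hlim : Filter.Tendsto (fun n : ℕ => b ^ n * (1 - b)⁻¹) Filter.atTop (nhds 0) := by
    simpa using (tendsto_pow_atTop_nhds_zero_of_lt_one h.pos.le h.lt_one).mul_const (1 - b)⁻¹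
  linarith [ge_of_tendsto' hlim fun j => key j ω hω h0]

lemma core_le_val (h : CriticalSystem W b c α β) {ω : Omega} (hω : ω ∈ coreSet α β)
    (h1 : ω 0 = true) : c ≤ val b ω := by
  have := h.flip.core_val_le (flipDigits_mem_coreSet hω) (by simpa using h1)
  rw [val_flipDigits h.pos.le h.lt_one] at this
  linarith

lemma core_gap (h : CriticalSystem W b c α β) {ω : Omega} (hω : ω ∈ coreSet α β) {k : ℕ}
    (hk : ∀ i < k, ω i = α i) (h0 : ω k = false) :
    b ^ k * (val b (shift^[k] α) - c) ≤ c - val b ω := by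
  have h2 := val_sub_val_of_agree h.pos.le h.lt_one (u := α) (v := ω) fun i hi => (hk i hi).symm
  have h3 := h.core_val_le (shift_iterate_mem_coreSet hω k) (by rwa [shift_iterate_zero])
  rw [h.val_left] at h2
  rw [h2]
  exact mul_le_mul_of_nonneg_left (by linarith) (pow_nonneg h.pos.le k)

lemma core_val_lt (h : CriticalSystem W b c α β) {ω : Omega} (hω : ω ∈ coreSet α β)
    (h0 : ω 0 = false) (hne : ω ≠ α) : val b ω < c := by
  obtain ⟨k, hk, hk0, hk1⟩ := lexLt_iff_exists.1 (((hω 0).1 h0).resolve_right hne)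
  have := h.core_gap hω hk hk0
  have := mul_pos (pow_pos h.pos k) (sub_pos.2 (h.lt_val_shift_left hk1))
  linarith

lemma core_lt_val (h : CriticalSystem W b c α β) {ω : Omega} (hω : ω ∈ coreSet α β)
    (h1 : ω 0 = true) (hne : ω ≠ β) : c < val b ω := by
  have := h.flip.core_val_lt (flipDigits_mem_coreSet hω) (by simpa using h1) fun he =>
    hne (by simpa using congrArg flipDigits he)
  rw [val_flipDigits h.pos.le h.lt_one] at this
  linarith

lemma exists_agree_left (h : CriticalSystem W b c α β) (k : ℕ) :
    ∃ δ > 0, ∀ ω ∈ coreSet α β, ω 0 = false → c - val b ω < δ → ∀ i < k, ω i = α i := by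
  induction k with
  | zero => exact ⟨1, one_pos, by simp⟩
  | succ k ih =>
    obtain ⟨δ, hδ, hagree⟩ := ih
    cases hk : α k with
    | false =>
      refine ⟨δ, hδ, fun ω hω h0 hd i hi => ?_⟩
      have hag := hagree ω hω h0 hd
      rcases Nat.lt_succ_iff_lt_or_eq.1 hi with hi | rfl
      · exact hag i hi
      · rw [hk]
        by_contra hc
        exact not_lexLt.2 ((hω 0).1 h0)
          (lexLt_iff_exists.2 ⟨i, fun j hj => (hag j hj).symm, hk, by simpa using hc⟩)
    | true =>
      refine ⟨min δ (b ^ k * (val b (shift^[k] α) - c)), lt_min hδ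
        (mul_pos (pow_pos h.pos k) (sub_pos.2 (h.lt_val_shift_left hk))), fun ω hω h0 hd i hi => ?_⟩
      have hag := hagree ω hω h0 (hd.trans_le (min_le_left _ _))
      rcases Nat.lt_succ_iff_lt_or_eq.1 hi with hi | rfl
      · exact hag i hi
      · rw [hk]
        by_contra hc
        have := h.core_gap hω hag (by simpa using hc)
        linarith [hd.trans_le (min_le_right _ _)]

lemma exists_agree_right (h : CriticalSystem W b c α β) (k : ℕ) :
    ∃ δ > 0, ∀ ω ∈ coreSet α β, ω 0 = true → val b ω - c < δ → ∀ i < k, ω i = β i := by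
  obtain ⟨δ, hδ, hagree⟩ := h.flip.exists_agree_left k
  refine ⟨δ, hδ, fun ω hω h1 hd i hi => ?_⟩
  have := hagree _ (flipDigits_mem_coreSet hω) (by simpa using h1)
    (by rw [val_flipDigits h.pos.le h.lt_one]; linarith) i hi
  simpa using this

/-! ### Absence of smaller solutions of the series equation -/

/-- `val x` varies at most by `K` times the variation of `val b`, up to an error `e`. -/
def ValBound (S : Set Omega) (b x K e : ℝ) : Prop :=
  ∀ u ∈ S, ∀ v ∈ S, |val x u - val x v| ≤ K * |val b u - val b v| + e

variable {x K e : ℝ}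

lemma valBound_of_forall_head (hb0 : 0 < b) (hb1 : b < 1) (hx : 0 < x) (hxb : x < b) (hK : 0 ≤ K)
    (he : 0 ≤ e)
    (hmain : ∀ u ∈ coreSet α β, ∀ v ∈ coreSet α β, u 0 = false → v 0 = true →
      |val x u - val x v| ≤ K * |val b u - val b v| + e) :
    ValBound (coreSet α β) b x K e := by
  have key : ∀ u ∈ coreSet α β, ∀ v ∈ coreSet α β, lexLt u v →
      |val x u - val x v| ≤ K * |val b u - val b v| + e := by
    intro u hu v hv huv
    obtain ⟨n, hn, h0, h1⟩ := lexLt_iff_exists.1 huv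
    have hx1 : x < 1 := hxb.trans hb1
    rw [val_sub_val_of_agree hx.le hx1 hn, val_sub_val_of_agree hb0.le hb1 hn, abs_mul, abs_mul,
      abs_of_pos (pow_pos hx n), abs_of_pos (pow_pos hb0 n)]
    have := hmain _ (shift_iterate_mem_coreSet hu n) _ (shift_iterate_mem_coreSet hv n)
      (by rwa [shift_iterate_zero]) (by rwa [shift_iterate_zero])
    have h2 := mul_le_mul_of_nonneg_left this (pow_pos hx n).le
    have h3 : x ^ n ≤ b ^ n := pow_le_pow_left₀ hx.le hxb.le n
    have h4 : x ^ n ≤ 1 := pow_le_one₀ hx.le hx1.le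
    have h5 := mul_le_mul_of_nonneg_right h3
      (mul_nonneg hK (abs_nonneg (val b (shift^[n] u) - val b (shift^[n] v))))
    have h6 := mul_le_mul_of_nonneg_right h4 he
    linarith
  intro u hu v hv
  by_cases huv : u = v
  · subst huv
    simpa using he
  · rcases lexLt_or_lexLt_of_ne huv with hlt | hlt
    · exact key u hu v hv hlt
    · rw [abs_sub_comm (val x u), abs_sub_comm (val b u)]
      exact key v hv u hu hlt

lemma ValBound.of_agree (h : ValBound (coreSet α β) b x K e) (hb0 : 0 < b) (hb1 : b < 1)
    (hx : 0 < x) (hxb : x < b) {u v : Omega} (hu : u ∈ coreSet α β)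
    (hv : v ∈ coreSet α β) {k : ℕ} (hk : ∀ i < k, u i = v i) :
    |val x u - val x v| ≤ (x / b) ^ k * K * |val b u - val b v| + x ^ k * e := by
  have hx1 : x < 1 := hxb.trans hb1
  rw [val_sub_val_of_agree hx.le hx1 hk, val_sub_val_of_agree hb0.le hb1 hk, abs_mul, abs_mul,
    abs_of_pos (pow_pos hx k), abs_of_pos (pow_pos hb0 k), div_pow]
  have := mul_le_mul_of_nonneg_left
    (h _ (shift_iterate_mem_coreSet hu k) _ (shift_iterate_mem_coreSet hv k)) (pow_pos hx k).le
  have hbk := (pow_pos hb0 k).ne'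
  refine this.trans (le_of_eq ?_)
  field_simp

lemma abs_val_sub_le_add (hαβ : val x α = val x β) (u v : Omega) :
    |val x u - val x v| ≤ |val x u - val x α| + |val x v - val x β| := by
  calc |val x u - val x v| = |(val x u - val x α) - (val x v - val x β)| := by
        rw [hαβ]; congr 1; ring
    _ ≤ _ := abs_sub _ _

lemma abs_val_sub_eq_add (h : CriticalSystem W b c α β) {u v : Omega} (hu : u ∈ coreSet α β)
    (hv : v ∈ coreSet α β) (h0 : u 0 = false) (h1 : v 0 = true) :
    |val b u - val b v| = |val b u - val b α| + |val b v - val b β| := by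
  have hu' := h.core_val_le hu h0
  have hv' := h.core_le_val hv h1
  rw [h.val_left, h.val_right, abs_of_nonpos (by linarith), abs_of_nonpos (by linarith),
    abs_of_nonneg (by linarith)]
  ring

lemma exists_valBound (h : CriticalSystem W b c α β) (hx : 0 < x) (hxb : x < b)
    (hαβ : val x α = val x β) : ∃ K, 0 ≤ K ∧ ValBound (coreSet α β) b x K 0 := by
  have hx1 : x < 1 := hxb.trans h.lt_one
  have hD : 0 < (1 - x)⁻¹ := inv_pos.2 (by linarith)
  obtain ⟨k, hk⟩ := exists_pow_lt_of_lt_one (show (0 : ℝ) < 1 / 4 by norm_num) hx1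
  obtain ⟨δ₁, hδ₁, hl⟩ := h.exists_agree_left k
  obtain ⟨δ₂, hδ₂, hr⟩ := h.exists_agree_right k
  set δ := min δ₁ δ₂ with hδdef
  have hδ : 0 < δ := lt_min hδ₁ hδ₂
  set K := (1 - x)⁻¹ / δ with hKdef
  have hK : 0 ≤ K := (div_pos hD hδ).le
  have hbound : ∀ j : ℕ, ValBound (coreSet α β) b x K ((1 / 2) ^ j * (1 - x)⁻¹) := by
    intro j
    induction j with
    | zero =>
      intro u _ v _
      have := mul_nonneg hK (abs_nonneg (val b u - val b v))
      linarith [abs_val_sub_val_le hx.le hx1 u v]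
    | succ j ih =>
      have he : 0 ≤ (1 / 2 : ℝ) ^ j * (1 - x)⁻¹ := by positivity
      refine valBound_of_forall_head h.pos h.lt_one hx hxb hK (by positivity) ?_
      intro u hu v hv h0 h1
      by_cases hfar : δ ≤ |val b u - val b v|
      · have h2 := mul_le_mul_of_nonneg_left hfar hK
        rw [hKdef, div_mul_cancel₀ _ hδ.ne', ← hKdef] at h2
        have h3 : 0 ≤ (1 / 2 : ℝ) ^ (j + 1) * (1 - x)⁻¹ := by positivity
        linarith [abs_val_sub_val_le hx.le hx1 u v]
      · push Not at hfar
        have hsum := h.abs_val_sub_eq_add hu hv h0 h1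
        have hu1 := ih.of_agree h.pos h.lt_one hx hxb hu h.left_mem_coreSet <| hl u hu h0 <| by
          have h2 := neg_abs_le (val b u - val b α)
          have h3 := abs_nonneg (val b v - val b β)
          have h4 : δ ≤ δ₁ := min_le_left _ _
          rw [h.val_left] at h2 hsum
          linarith
        have hv1 := ih.of_agree h.pos h.lt_one hx hxb hv h.right_mem_coreSet <| hr v hv h1 <| by
          have h2 := le_abs_self (val b v - val b β)
          have h3 := abs_nonneg (val b u - val b α)
          have h4 : δ ≤ δ₂ := min_le_right _ _
          rw [h.val_right] at h2 hsum
          linarith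
        have hq : (x / b) ^ k * K ≤ K := by
          refine mul_le_of_le_one_left hK (pow_le_one₀ (div_pos hx h.pos).le ?_)
          exact (div_le_one h.pos).2 hxb.le
        have hq1 := mul_le_mul_of_nonneg_right hq (abs_nonneg (val b u - val b α))
        have hq2 := mul_le_mul_of_nonneg_right hq (abs_nonneg (val b v - val b β))
        have hx4 := mul_le_mul_of_nonneg_right hk.le he
        rw [hsum, pow_succ]
        linarith [abs_val_sub_le_add hαβ u v]
  refine ⟨K, hK, fun u hu v hv => ?_⟩
  have hlim : Filter.Tendsto (fun j : ℕ => K * |val b u - val b v| + (1 / 2 : ℝ) ^ j * (1 - x)⁻¹)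
      Filter.atTop (nhds (K * |val b u - val b v| + 0)) := by
    have := (tendsto_pow_atTop_nhds_zero_of_lt_one (show (0 : ℝ) ≤ 1 / 2 by norm_num)
      (by norm_num)).mul_const (1 - x)⁻¹
    rw [zero_mul] at this
    exact this.const_add _
  exact ge_of_tendsto' hlim fun j => hbound j u hu v hv

lemma ValBound.contract (h : CriticalSystem W b c α β) (hx : 0 < x) (hxb : x < b)
    (hαβ : val x α = val x β) (hK : 0 ≤ K) (hB : ValBound (coreSet α β) b x K 0) :
    ValBound (coreSet α β) b x (x / b * K) 0 := by
  refine valBound_of_forall_head h.pos h.lt_one hx hxb (mul_nonneg (div_pos hx h.pos).le hK)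
    le_rfl fun u hu v hv h0 h1 => ?_
  have hu1 := hB.of_agree h.pos h.lt_one hx hxb hu h.left_mem_coreSet (k := 1) fun i hi => by
    rw [Nat.lt_one_iff.1 hi, h0, h.left_zero]
  have hv1 := hB.of_agree h.pos h.lt_one hx hxb hv h.right_mem_coreSet (k := 1) fun i hi => by
    rw [Nat.lt_one_iff.1 hi, h1, h.right_zero]
  rw [h.abs_val_sub_eq_add hu hv h0 h1]
  simp only [pow_one, mul_zero, add_zero] at hu1 hv1 ⊢
  linarith [abs_val_sub_le_add hαβ u v]

theorem val_left_ne_val_right (h : CriticalSystem W b c α β) (hx : 0 < x) (hxb : x < b) :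
    val x α ≠ val x β := by
  intro hαβ
  have hx1 : x < 1 := hxb.trans h.lt_one
  have hq0 : 0 ≤ x / b := (div_pos hx h.pos).le
  have hq1 : x / b < 1 := (div_lt_one h.pos).2 hxb
  obtain ⟨K, hK, hB⟩ := h.exists_valBound hx hxb hαβ
  have hpow : ∀ j : ℕ, ValBound (coreSet α β) b x ((x / b) ^ j * K) 0 := by
    intro j
    induction j with
    | zero => simpa using hB
    | succ j ih =>
      have := ValBound.contract h hx hxb hαβ (mul_nonneg (pow_nonneg hq0 j) hK) ih
      rwa [← mul_assoc, ← pow_succ'] at this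
  set z : Omega := fun _ => false with hz
  have hz0 : ∀ n, shift^[n] z = z := fun n => by funext i; rw [shift_iterate_apply]
  have hzmem : z ∈ coreSet α β := by
    refine fun n => ⟨fun _ => ?_, fun hn => by simp [hz] at hn⟩
    rw [hz0, ← not_lexLt, lexLt_iff_exists]
    rintro ⟨k, -, -, hk⟩
    simp [hz] at hk
  have hvz : val x z = 0 := by simp [val, hz]
  have hlim : Filter.Tendsto (fun j : ℕ => (x / b) ^ j * K * |val b β - val b z| + 0)
      Filter.atTop (nhds 0) := by
    simpa using ((tendsto_pow_atTop_nhds_zero_of_lt_one hq0 hq1).mul_const K).mul_const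
      |val b β - val b z|
  have := ge_of_tendsto' hlim fun j => hpow j β h.right_mem_coreSet z hzmem
  have h1 := one_le_val hx.le hx1 h.right_zero
  rw [hvz, sub_zero] at this
  linarith [le_abs_self (val x β)]

end CriticalSystem

/-! ### Growth -/

lemma log_ncard_initSegs_div_le (V : Set Omega) (n : ℕ) :
    Real.log ((initSegs V n).ncard) / (n : ℝ) ≤ Real.log 2 := by
  rcases Nat.eq_zero_or_pos n with rfl | hn
  · simpa using Real.log_nonneg one_le_two
  have hcard : (initSegs V n).ncard ≤ 2 ^ n := by
    have := Set.ncard_le_ncard (Set.subset_univ (initSegs V n))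
    simpa [Set.ncard_univ] using this
  rw [div_le_iff₀ (by exact_mod_cast hn), mul_comm, ← Real.log_pow]
  rcases Nat.eq_zero_or_pos (initSegs V n).ncard with h0 | hpos
  · rw [h0, Nat.cast_zero, Real.log_zero]
    exact Real.log_nonneg (one_le_pow₀ one_le_two)
  · exact Real.log_le_log (by exact_mod_cast hpos) (by exact_mod_cast hcard)

lemma le_ncard_initSegs {V : Set Omega} {b t : ℝ} (hb0 : 0 < b) (hb1 : b < 1) (ht : 0 < t)
    (hV : ∀ y, 0 ≤ y → y ≤ t → ∃ w ∈ V, val b w = y) (n : ℕ) :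
    t * (1 - b) / 2 * (b⁻¹) ^ n ≤ (initSegs V n).ncard := by
  have hpow := pow_pos hb0 n
  have h1b : 0 < 1 - b := by linarith
  set s := 2 * (1 - b)⁻¹ * b ^ n with hs
  have hs0 : 0 < s := by positivity
  have hpt : ∀ i : Fin (⌊t / s⌋₊ + 1), ∃ w ∈ V, val b w = i * s := fun i => by
    refine hV _ (by positivity) ?_
    have h1 : ((i : ℕ) : ℝ) ≤ ⌊t / s⌋₊ := by exact_mod_cast Nat.lt_succ_iff.1 i.2
    exact (le_div_iff₀ hs0).1 (h1.trans (Nat.floor_le (div_pos ht hs0).le))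
  choose w hwV hw using hpt
  have hinj : Function.Injective fun i (j : Fin n) => w i j := by
    intro i j hij
    have hag : ∀ k < n, w i k = w j k := fun k hk => congrFun hij ⟨k, hk⟩
    have hle := abs_val_sub_val_le_of_agree hb0.le hb1 hag
    rw [hw, hw, ← sub_mul, abs_mul, abs_of_pos hs0] at hle
    have h3 : |((i : ℕ) : ℝ) - ((j : ℕ) : ℝ)| < 1 := by
      by_contra! hc
      have h4 := mul_le_mul_of_nonneg_right hc hs0.le
      have h5 : 0 < b ^ n * (1 - b)⁻¹ := by positivity
      have h6 : s = 2 * (b ^ n * (1 - b)⁻¹) := by rw [hs]; ring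
      linarith
    have h4 : |((i : ℕ) : ℤ) - ((j : ℕ) : ℤ)| < 1 := by exact_mod_cast h3
    have h5 := Int.abs_lt_one_iff.1 h4
    exact Fin.ext (by omega)
  have hcard : ⌊t / s⌋₊ + 1 ≤ (initSegs V n).ncard := by
    have hsub : Set.range (fun i (j : Fin n) => w i j) ⊆ initSegs V n := by
      rintro _ ⟨i, rfl⟩
      exact ⟨w i, hwV i, rfl⟩
    have := Set.ncard_le_ncard hsub
    rwa [← Set.image_univ, Set.ncard_image_of_injective _ hinj, Set.ncard_univ,
      Nat.card_eq_fintype_card, Fintype.card_fin] at this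
  have hfl := Nat.lt_floor_add_one (t / s)
  have hc' : (⌊t / s⌋₊ : ℝ) + 1 ≤ (initSegs V n).ncard := by exact_mod_cast hcard
  have heq : t * (1 - b) / 2 * (b⁻¹) ^ n = t / s := by
    rw [hs, inv_pow]
    field_simp
  rw [heq]
  linarith

lemma growth_ne_zero {V : Set Omega} {b t : ℝ} (hb0 : 0 < b) (hb1 : b < 1) (ht : 0 < t)
    (hV : ∀ y, 0 ≤ y → y ≤ t → ∃ w ∈ V, val b w = y) : growth V ≠ 0 := by
  intro h0
  have hlog : 0 < Real.log b⁻¹ := Real.log_pos ((one_lt_inv₀ hb0).2 hb1)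
  set C := t * (1 - b) / 2 with hC
  have hCpos : 0 < C := by
    have : 0 < 1 - b := by linarith
    positivity
  have hlt := Filter.eventually_lt_of_limsup_lt (show Filter.limsup
      (fun n : ℕ => Real.log ((initSegs V n).ncard) / (n : ℝ)) Filter.atTop < Real.log b⁻¹ / 2 by
        rw [show Filter.limsup (fun n : ℕ => Real.log ((initSegs V n).ncard) / (n : ℝ))
          Filter.atTop = 0 from h0]
        linarith)
    (Filter.isBoundedUnder_of ⟨Real.log 2, log_ncard_initSegs_div_le V⟩)
  have hlim : Filter.Tendsto (fun n : ℕ => Real.log C / (n : ℝ)) Filter.atTop (nhds 0) :=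
    tendsto_const_div_atTop_nhds_zero_nat _
  have hgt := hlim.eventually_const_lt (show -(Real.log b⁻¹ / 2) < 0 by linarith)
  obtain ⟨n, ⟨h1, h2⟩, hn⟩ := ((hlt.and hgt).and (Filter.eventually_gt_atTop 0)).exists
  have hn' : (0 : ℝ) < n := by exact_mod_cast hn
  have hle := Real.log_le_log (by positivity) (le_ncard_initSegs hb0 hb1 ht hV n)
  rw [Real.log_mul hCpos.ne' (by positivity), Real.log_pow] at hle
  rw [div_lt_iff₀ hn'] at h1
  rw [lt_div_iff₀ hn'] at h2
  linarith

/-! ### Sets of strings filling an interval -/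

/-- A set `W` of strings, closed under shifts and prepending `0`, that `val b` maps strictly
increasingly onto a nondegenerate interval starting at `0`. -/
structure FillingSet (W : Set Omega) (b : ℝ) : Prop where
  pos : 0 < b
  lt_one : b < 1
  shift_mem : ∀ u ∈ W, shift u ∈ W
  cons0_mem : ∀ u ∈ W, cons0 u ∈ W
  mono : ∀ u ∈ W, ∀ v ∈ W, lexLt u v → val b u < val b v
  exists_val_eq : ∀ u ∈ W, ∀ y, 0 ≤ y → y ≤ val b u → ∃ w ∈ W, val b w = y
  exists_head : ∃ u ∈ W, u 0 = true

namespace FillingSet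

variable {W : Set Omega} {b : ℝ}

lemma exists_criticalSystem (h : FillingSet W b) :
    ∃ α β c, CriticalSystem W b c α β ∧ ∃ t ∈ W, c < val b t := by
  obtain ⟨w, hw, hw1⟩ := h.exists_head
  obtain ⟨α, hα⟩ := exists_isLexSup (W := {u ∈ W | u 0 = false}) ⟨cons0 w, h.cons0_mem w hw, rfl⟩
  obtain ⟨β', hβ'⟩ := exists_isLexSup (W := {u | flipDigits u ∈ W ∧ u 0 = false})
    ⟨flipDigits w, by simpa using hw, by simpa using hw1⟩
  obtain ⟨β, rfl⟩ : ∃ β, β' = flipDigits β := ⟨flipDigits β', by simp⟩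
  have hflip := fun u => val_flipDigits h.pos.le h.lt_one u
  have hlo : ∀ u ∈ W, u 0 = false → val b u ≤ val b α := fun u hu h0 =>
    hα.val_le h.pos.le h.lt_one (fun u hu v hv => h.mono u hu.1 v hv.1) ⟨hu, h0⟩
  have hhi : ∀ v ∈ W, v 0 = true → val b β ≤ val b v := fun v hv h1 => by
    have := hβ'.val_le h.pos.le h.lt_one (fun u hu v hv huv => ?_)
      (u := flipDigits v) ⟨by simpa using hv, by simpa using h1⟩
    · rw [hflip, hflip] at this
      linarith
    · have := h.mono _ hv.1 _ hu.1 (lexLt_flipDigits.2 huv)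
      rw [hflip, hflip] at this
      linarith
  have hαle : ∀ v ∈ W, v 0 = true → val b α ≤ val b v := fun v hv h1 =>
    hα.val_le_of_forall_val_le h.pos.le h.lt_one fun u hu =>
      (h.mono u hu.1 v hv (lexLt_of_head hu.2 h1)).le
  have hαβ : val b α ≤ val b β := by
    have := hβ'.val_le_of_forall_val_le h.pos.le h.lt_one (c := (1 - b)⁻¹ - val b α) fun u hu => by
      have := hαle _ hu.1 (by simpa using hu.2)
      rw [hflip] at this
      linarith
    rw [hflip] at this
    linarith
  have ht : ∃ t ∈ W, val b α < val b t := by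
    rcases (hαle w hw hw1).lt_or_eq with hlt | heq
    · exact ⟨w, hw, hlt⟩
    · by_contra! hc
      have hle : val b α ≤ b * val b α :=
        hα.val_le_of_forall_val_le h.pos.le h.lt_one fun u hu => by
          rw [val_of_head_false h.pos.le h.lt_one hu.2]
          exact mul_le_mul_of_nonneg_left (hc _ (h.shift_mem u hu.1)) h.pos.le
      have h1 := one_le_val h.pos.le h.lt_one hw1
      rw [← heq] at h1
      have := mul_pos (sub_pos.2 h.lt_one) (lt_of_lt_of_le one_pos h1)
      linarith
  obtain ⟨t, htW, htc⟩ := ht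
  have hβα : val b β ≤ val b α := by
    by_contra! hlt
    set y := min ((val b α + val b β) / 2) (val b t) with hy
    have hy1 : val b α < y := lt_min (by linarith) htc
    have hy2 : y < val b β := (min_le_left _ _).trans_lt (by linarith)
    obtain ⟨v, hv, hvy⟩ := h.exists_val_eq t htW y
      ((val_nonneg h.pos.le α).trans hy1.le) (min_le_right _ _)
    cases hv0 : v 0 with
    | false => linarith [hlo v hv hv0]
    | true => linarith [hhi v hv hv0]
  have heq : val b β = val b α := le_antisymm hβα hαβ
  refine ⟨α, β, val b α, ⟨h.pos, h.lt_one, h.shift_mem, h.mono, hα, hβ', rfl, heq, ?_⟩, t, htW, htc⟩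
  have hα0 : α 0 = false := by
    obtain ⟨u, hu, hn⟩ := hα.approx 1
    rw [← hn 0 one_pos, hu.2]
  have hβ1 : β 0 = true := by
    obtain ⟨u, hu, hn⟩ := hβ'.approx 1
    have := hn 0 one_pos
    rw [hu.2] at this
    simpa using this.symm
  constructor
  · intro hαW hβW
    have := h.mono _ hαW _ hβW (lexLt_of_head hα0 hβ1)
    linarith
  · intro hβW
    obtain ⟨v, hv, hvy⟩ := h.exists_val_eq t htW (val b α) (val_nonneg h.pos.le α) htc.le
    cases hv0 : v 0 with
    | false =>
      rcases hα.le v ⟨hv, hv0⟩ with hlt | rfl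
      · obtain ⟨v', hv', hlt'⟩ := hα.exists_gt hlt
        linarith [h.mono _ hv _ hv'.1 hlt', hlo _ hv'.1 hv'.2]
      · exact hv
    | true =>
      exfalso
      rcases hβ'.le (flipDigits v) ⟨by simpa using hv, by simpa using hv0⟩ with hlt | he
      · obtain ⟨v', hv', hlt'⟩ := hβ'.exists_gt hlt
        rw [← flipDigits_flipDigits v', lexLt_flipDigits] at hlt'
        linarith [h.mono _ hv'.1 _ hv hlt', hhi _ hv'.1 (by simpa using hv'.2)]
      · have hvβ : v = β := by simpa using congrArg flipDigits he
        exact hβW (hvβ ▸ hv)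

variable {c : ℝ} {α β : Omega}

lemma left_one (h : FillingSet W b) (hs : CriticalSystem W b c α β) : α 1 = true := by
  obtain ⟨w, hw, hw1⟩ := h.exists_head
  by_contra hc
  refine not_lexLt.2 (hs.le_left (h.cons0_mem w hw) rfl) (lexLt_iff_exists.2
    ⟨1, fun i hi => ?_, by simpa using hc, hw1⟩)
  rw [Nat.lt_one_iff.1 hi, hs.left_zero]
  rfl

lemma right_one (h : FillingSet W b) (hs : CriticalSystem W b c α β) {t : Omega} (ht : t ∈ W)
    (htc : c < val b t) : β 1 = false := by
  by_contra hc
  have hβ1 : β 1 = true := by simpa using hc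
  have hstep : ∀ v ∈ W, v 0 = true → v 1 = true := fun v hv hv0 => by
    by_contra hv1
    refine not_lexLt.2 (hs.right_le hv hv0) (lexLt_iff_exists.2
      ⟨1, fun i hi => ?_, by simpa using hv1, hβ1⟩)
    rw [Nat.lt_one_iff.1 hi, hs.right_zero, hv0]
  have hones : ∀ v ∈ W, v 0 = true → ∀ n, v n = true := fun v hv hv0 n => by
    induction n with
    | zero => exact hv0
    | succ n ih =>
      have := hstep _ (hs.shift_iterate_mem hv n) (by rwa [shift_iterate_zero])
      rwa [shift_iterate_apply] at this
  have huniq : ∀ v ∈ W, c < val b v → ∀ n, v n = true := fun v hv hcv => by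
    refine hones v hv ?_
    by_contra hv0
    linarith [hs.val_le hv (by simpa using hv0)]
  obtain ⟨v, hv, hvy⟩ := h.exists_val_eq t ht ((c + val b t) / 2)
    (by linarith [hs.val_left ▸ val_nonneg h.pos.le α]) (by linarith)
  have hvt : v = t := funext fun n => by
    rw [huniq v hv (by linarith) n, huniq t ht htc n]
  rw [hvt] at hvy
  linarith

lemma one_half_le (h : FillingSet W b) (hs : CriticalSystem W b c α β) : 1 / 2 ≤ b := by
  have h1 := one_le_val h.pos.le h.lt_one hs.right_zero
  have h2 := val_of_head_false h.pos.le h.lt_one hs.left_zero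
  rw [hs.val_right] at h1
  rw [hs.val_left] at h2
  have h3 := mul_le_mul_of_nonneg_left (val_le h.pos.le h.lt_one (shift α)) h.pos.le
  have h4 : 1 ≤ b * (1 - b)⁻¹ := by linarith
  rw [← div_eq_mul_inv, le_div_iff₀ (by linarith [h.lt_one])] at h4
  linarith

lemma mem_of_mem_coreSet (h : FillingSet W b) (hs : CriticalSystem W b c α β) {ω : Omega}
    (hω : ω ∈ coreSet α β) {u : Omega} (hu : u ∈ W) (hle : val b ω ≤ val b u)
    (hsep : (∀ n, shift^[n] ω ≠ α ∧ ∀ τ ∈ W, τ ≠ α) ∨ (∀ n, shift^[n] ω ≠ β ∧ ∀ τ ∈ W, τ ≠ β)) :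
    ω ∈ W := by
  obtain ⟨τ, hτ, hval⟩ := h.exists_val_eq u hu _ (val_nonneg h.pos.le ω) hle
  by_cases heq : ω = τ
  · rwa [heq]
  have key : ∀ v w : Omega, v ∈ coreSet α β → w ∈ coreSet α β → v 0 = false → w 0 = true →
      val b v = val b w → v = α ∧ w = β := fun v w hv hw h0 h1 he => by
    have h2 := hs.core_val_le hv h0
    have h3 := hs.core_le_val hw h1
    constructor
    · by_contra hne
      linarith [hs.core_val_lt hv h0 hne]
    · by_contra hne
      linarith [hs.core_lt_val hw h1 hne]
  have hshift : ∀ n, (∀ i < n, ω i = τ i) → val b (shift^[n] ω) = val b (shift^[n] τ) := by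
    intro n hn
    have := val_sub_val_of_agree h.pos.le h.lt_one hn
    rw [hval, sub_self, zero_eq_mul] at this
    exact sub_eq_zero.1 (this.resolve_left (pow_pos h.pos n).ne')
  have hτc := hs.mem_coreSet hτ
  exfalso
  rcases lexLt_or_lexLt_of_ne heq with hlt | hlt
  · obtain ⟨n, hn, h0, h1⟩ := lexLt_iff_exists.1 hlt
    have := key _ _ (shift_iterate_mem_coreSet hω n) (shift_iterate_mem_coreSet hτc n)
      (by rwa [shift_iterate_zero]) (by rwa [shift_iterate_zero]) (hshift n hn)
    rcases hsep with hsep | hsep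
    · exact (hsep n).1 this.1
    · exact (hsep n).2 _ (hs.shift_iterate_mem hτ n) this.2
  · obtain ⟨n, hn, h0, h1⟩ := lexLt_iff_exists.1 hlt
    have := key _ _ (shift_iterate_mem_coreSet hτc n) (shift_iterate_mem_coreSet hω n)
      (by rwa [shift_iterate_zero]) (by rwa [shift_iterate_zero])
      (hshift n fun i hi => (hn i hi).symm).symm
    rcases hsep with hsep | hsep
    · exact (hsep n).2 _ (hs.shift_iterate_mem hτ n) this.1
    · exact (hsep n).1 this.2

end FillingSet

namespace CriticalSystem

variable {W : Set Omega} {b c : ℝ} {α β : Omega}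

lemma subset_omegaMinus (h : CriticalSystem W b c α β) (hα : α ∈ W) : W ⊆ OmegaMinus α β := by
  rintro ω hω n ⟨h1, h2⟩
  have hmem := h.shift_iterate_mem hω n
  cases hn : shift^[n] ω 0 with
  | false => exact not_lexLt.2 (h.le_left hmem hn) h1
  | true =>
    have hne : β ≠ shift^[n] ω := fun he => h.mem_iff.1 hα (he ▸ hmem)
    exact not_lexLe.2 ((h.right_le hmem hn).resolve_right hne) h2

lemma subset_omegaPlus (h : CriticalSystem W b c α β) (hα : α ∉ W) : W ⊆ OmegaPlus α β := by
  rintro ω hω n ⟨h1, h2⟩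
  have hmem := h.shift_iterate_mem hω n
  cases hn : shift^[n] ω 0 with
  | false =>
    have hne : shift^[n] ω ≠ α := fun he => hα (he ▸ hmem)
    exact not_lexLe.2 ((h.le_left hmem hn).resolve_right hne) h1
  | true => exact not_lexLt.2 (h.right_le hmem hn) h2

lemma omegaMinus_subset (h : CriticalSystem W b c α β) : OmegaMinus α β ⊆ coreSet α β := by
  refine fun ω hω n => ⟨fun hn => ?_, fun hn => ?_⟩
  · have := lexLt_of_head (u := shift^[n] ω) (by rwa [shift_iterate_zero]) h.right_zero
    exact not_lexLt.1 fun hlt => hω n ⟨hlt, Or.inl this⟩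
  · have := lexLt_of_head (v := shift^[n] ω) h.left_zero (by rwa [shift_iterate_zero])
    exact Or.inl (not_lexLe.1 fun hle => hω n ⟨this, hle⟩)

lemma omegaPlus_subset (h : CriticalSystem W b c α β) : OmegaPlus α β ⊆ coreSet α β := by
  refine fun ω hω n => ⟨fun hn => ?_, fun hn => ?_⟩
  · have := lexLt_of_head (u := shift^[n] ω) (by rwa [shift_iterate_zero]) h.right_zero
    exact Or.inl (not_lexLe.1 fun hle => hω n ⟨hle, this⟩)
  · have := lexLt_of_head (v := shift^[n] ω) h.left_zero (by rwa [shift_iterate_zero])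
    exact not_lexLt.1 fun hlt => hω n ⟨Or.inl this, hlt⟩

lemma cons0_mem_coreSet {ω : Omega} (hω : ω ∈ coreSet α β) (hle : lexLe (cons0 ω) α) :
    cons0 ω ∈ coreSet α β := by
  intro n
  cases n with
  | zero => exact ⟨fun _ => hle, fun h => by simp [cons0] at h⟩
  | succ n => exact hω n

end CriticalSystem

namespace FillingSet

variable {W : Set Omega} {b c : ℝ} {α β : Omega}

lemma eq_omega0Minus (h : FillingSet W b) (hs : CriticalSystem W b c α β) (hα : α ∈ W) :
    W = Omega0Minus α β := by
  refine subset_antisymm (fun ω hω => ⟨hs.subset_omegaMinus hα hω,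
    hs.le_left (h.cons0_mem ω hω) rfl⟩) ?_
  rintro ω ⟨hω, hle⟩
  have hcore := hs.omegaMinus_subset hω
  have hv := hs.core_val_le (CriticalSystem.cons0_mem_coreSet hcore hle) rfl
  rw [← hs.val_left, val_cons0 h.pos.le h.lt_one,
    val_of_head_false h.pos.le h.lt_one hs.left_zero] at hv
  refine h.mem_of_mem_coreSet hs hcore (h.shift_mem α hα) (le_of_mul_le_mul_left hv h.pos)
    (Or.inr fun n => ⟨fun he => ?_, fun τ hτ he => hs.mem_iff.1 hα (he ▸ hτ)⟩)
  exact hω n ⟨he ▸ lexLt_of_head hs.left_zero hs.right_zero, Or.inr he⟩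

lemma eq_omega0Plus (h : FillingSet W b) (hs : CriticalSystem W b c α β) (hα : α ∉ W) :
    W = Omega0Plus α β := by
  refine subset_antisymm (fun ω hω => ⟨hs.subset_omegaPlus hα hω,
    (hs.le_left (h.cons0_mem ω hω) rfl).resolve_right fun he => hα (he ▸ h.cons0_mem ω hω)⟩) ?_
  rintro ω ⟨hω, hlt⟩
  have hcore := hs.omegaPlus_subset hω
  have hv := hs.core_val_lt (CriticalSystem.cons0_mem_coreSet hcore (Or.inl hlt)) rfl
    fun he => lexLt_irrefl α (by rwa [he] at hlt)
  obtain ⟨u, hu, huv⟩ : ∃ u ∈ {u ∈ W | u 0 = false}, val b (cons0 ω) < val b u := by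
    by_contra! hc
    have := hs.isLexSup.val_le_of_forall_val_le h.pos.le h.lt_one hc
    rw [hs.val_left] at this
    linarith
  rw [val_cons0 h.pos.le h.lt_one, val_of_head_false h.pos.le h.lt_one hu.2] at huv
  refine h.mem_of_mem_coreSet hs hcore (h.shift_mem u hu.1) (le_of_mul_le_mul_left huv.le h.pos)
    (Or.inl fun n => ⟨fun he => ?_, fun τ hτ he => hα (he ▸ hτ)⟩)
  exact hω n ⟨Or.inr he.symm, he ▸ lexLt_of_head hs.left_zero hs.right_zero⟩

theorem exists_pair (h : FillingSet W b) :
    ∃ α β : Omega, Admissible α β ∧ growth (OmegaUnion α β) ≠ 0 ∧ IsLeast (baseSet α β) b ∧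
      (W = Omega0Minus α β ∨ W = Omega0Plus α β) := by
  obtain ⟨α, β, c, hs, t, ht, htc⟩ := h.exists_criticalSystem
  have hc : 0 ≤ c := hs.val_left ▸ val_nonneg h.pos.le α
  have hsub : W ⊆ OmegaUnion α β := by
    by_cases hα : α ∈ W
    · exact (hs.subset_omegaMinus hα).trans Set.subset_union_left
    · exact (hs.subset_omegaPlus hα).trans Set.subset_union_right
  refine ⟨α, β, hs.admissible (h.left_one hs) (h.right_one hs ht htc), ?_, ⟨⟨⟨h.one_half_le hs,
    h.lt_one⟩, hs.val_left.trans hs.val_right.symm⟩, ?_⟩, ?_⟩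
  · refine growth_ne_zero h.pos h.lt_one (hc.trans_lt htc) fun y hy0 hy => ?_
    obtain ⟨w, hw, hwy⟩ := h.exists_val_eq t ht y hy0 hy
    exact ⟨w, hsub hw, hwy⟩
  · rintro x ⟨⟨hx, -⟩, heq⟩
    by_contra! hxb
    exact hs.val_left_ne_val_right (by linarith) hxb heq
  · by_cases hα : α ∈ W
    · exact Or.inl (h.eq_omega0Minus hs hα)
    · exact Or.inr (h.eq_omega0Plus hs hα)

end FillingSet

/-! ### Binary radix systems -/

/-- The decimal with digits `u` from position `0` on. -/
def toDecimal (u : Omega) : ℤ → Bool := fun j => if 0 ≤ j then u j.toNat else false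

lemma toDecimal_natCast (u : Omega) (n : ℕ) : toDecimal u n = u n := by
  simp [toDecimal]

lemma toDecimal_of_neg (u : Omega) {j : ℤ} (hj : j < 0) : toDecimal u j = false := by
  simp [toDecimal, not_le.2 hj]

lemma radixVal_toDecimal (B : ℝ) (u : Omega) : radixVal B (toDecimal u) = val B⁻¹ u := by
  rw [radixVal, val, ← (Nat.cast_injective (R := ℤ)).tsum_eq]
  · refine tsum_congr fun n => ?_
    rw [toDecimal_natCast, zpow_neg, zpow_natCast, inv_pow]
  · intro j hj
    by_contra hc
    have hneg : j < 0 := by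
      by_contra! h0
      exact hc ⟨j.toNat, Int.toNat_of_nonneg h0⟩
    exact hj (by simp [toDecimal_of_neg u hneg])

lemma decLt_toDecimal {u v : Omega} (h : lexLt u v) : decLt (toDecimal u) (toDecimal v) := by
  obtain ⟨k, hk, hlt⟩ := h
  refine ⟨k, fun i hi => ?_, by rwa [toDecimal_natCast, toDecimal_natCast]⟩
  rcases lt_or_ge i 0 with h0 | h0
  · rw [toDecimal_of_neg u h0, toDecimal_of_neg v h0]
  · lift i to ℕ using h0
    rw [toDecimal_natCast, toDecimal_natCast]
    exact hk i (by exact_mod_cast hi)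

namespace BinaryRadixSystem

/-- The strings whose decimals starting at position `0` belong to the system. -/
def strings (R : BinaryRadixSystem) : Set Omega := {u | toDecimal u ∈ R.Γ}

variable (R : BinaryRadixSystem)

lemma tail_mem_strings {d : ℤ → Bool} (hd : d ∈ R.Γ) (m : ℤ) :
    (fun n : ℕ => d (m + n)) ∈ R.strings := by
  have := R.hshift _ hd m 0
  change toDecimal _ ∈ R.Γ
  convert this using 1
  funext j
  by_cases hj : 0 ≤ j
  · simp only [toDecimal, if_pos hj, Int.toNat_of_nonneg hj, add_comm]
  · simp only [toDecimal, if_neg hj]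

lemma Γ_eq_dot : R.Γ = dot R.strings := by
  ext d
  constructor
  · intro hd
    obtain ⟨m, hm⟩ := R.hdec d hd
    exact ⟨m, _, R.tail_mem_strings hd m, hm, fun _ => rfl⟩
  · rintro ⟨m, γ, hγ, hm, hd⟩
    have := R.hshift _ hγ (-m) m
    convert this using 1
    funext j
    by_cases hj : m ≤ j
    · rw [if_pos hj]
      obtain ⟨i, rfl⟩ := Int.le.dest hj
      rw [hd, show m + (i : ℤ) + -m = i by ring, toDecimal_natCast]
    · rw [if_neg hj]
      exact hm j (not_le.1 hj)

lemma toDecimal_tail {d : ℤ → Bool} (hd : ∀ j < 0, d j = false) :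
    toDecimal (fun n => d n) = d := by
  funext j
  rcases lt_or_ge j 0 with hj | hj
  · rw [toDecimal_of_neg _ hj, hd j hj]
  · lift j to ℕ using hj
    rw [toDecimal_natCast]

lemma fillingSet : FillingSet R.strings R.B⁻¹ where
  pos := inv_pos.2 (one_pos.trans R.hB)
  lt_one := inv_lt_one_of_one_lt₀ R.hB
  shift_mem u hu := by
    convert R.tail_mem_strings hu 1 using 1
    funext n
    rw [add_comm, show (n : ℤ) + 1 = ((n + 1 : ℕ) : ℤ) by push_cast; rfl, toDecimal_natCast]
    rfl
  cons0_mem u hu := by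
    convert R.tail_mem_strings hu (-1) using 1
    funext n
    cases n with
    | zero => rfl
    | succ n =>
      rw [show (-1 : ℤ) + ((n + 1 : ℕ) : ℤ) = n by push_cast; ring, toDecimal_natCast]
      rfl
  mono u hu v hv huv := by
    simpa only [radixVal_toDecimal] using R.hmono _ hu _ hv (decLt_toDecimal huv)
  exists_val_eq u hu y hy0 hy := by
    obtain ⟨d, hd, rfl⟩ := R.hbij.surjOn (Set.mem_Ici.2 hy0)
    have hneg : ∀ j < 0, d j = false := by
      by_contra! hc
      obtain ⟨j, hj, hdj⟩ := hc
      obtain ⟨m, hm⟩ := R.hdec d hd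
      obtain ⟨k, hk, hkmin⟩ := Int.exists_least_of_bdd (P := fun j => d j = true)
        ⟨m, fun z hz => by
          by_contra! hlt
          simp [hm z hlt] at hz⟩ ⟨j, by simpa using hdj⟩
      have hk0 : k < 0 := (hkmin j (by simpa using hdj)).trans_lt hj
      have hlt : decLt (toDecimal u) d := by
        refine ⟨k, fun i hi => ?_, by rw [toDecimal_of_neg u hk0, hk]; exact Bool.false_lt_true⟩
        rw [toDecimal_of_neg u (hi.trans hk0)]
        by_contra hne
        exact absurd (hkmin i (by simpa using Ne.symm hne)) (not_le.2 hi)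
      have := R.hmono _ hu _ hd hlt
      rw [radixVal_toDecimal] at this
      linarith
    have heq := toDecimal_tail hneg
    refine ⟨fun n => d n, ?_, ?_⟩
    · change toDecimal _ ∈ R.Γ
      rwa [heq]
    · rw [← radixVal_toDecimal, heq]
  exists_head := by
    obtain ⟨d, hd, hval⟩ := R.hbij.surjOn (Set.mem_Ici.2 zero_le_one)
    obtain ⟨j, hj⟩ : ∃ j, d j = true := by
      by_contra! hc
      have : d = fun _ => false := funext fun j => by simpa using hc j
      simp [this, radixVal] at hval
    exact ⟨_, R.tail_mem_strings hd j, by simpa using hj⟩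

end BinaryRadixSystem

/-- Every binary radix system `(Γ, π, B)` arises from an admissible
non-null pair: there exist such `(α,β)` with `B = B_{(α,β)}` and `Γ = Ω^•_{(α,β,−)}`
or `Γ = Ω^•_{(α,β,+)}`. -/
theorem stmt_13 (R : BinaryRadixSystem) :
    ∃ α β : Omega, ∃ b : ℝ,
      Admissible α β ∧ growth (OmegaUnion α β) ≠ 0 ∧
      IsLeast (baseSet α β) b ∧ R.B = 1 / b ∧
      (R.Γ = dotMinus α β ∨ R.Γ = dotPlus α β) := by
  obtain ⟨α, β, hadm, hgrowth, hleast, hΓ⟩ := R.fillingSet.exists_pair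
  refine ⟨α, β, R.B⁻¹, hadm, hgrowth, hleast, by rw [one_div, inv_inv], ?_⟩
  rw [R.Γ_eq_dot]
  exact hΓ.imp (congrArg dot) (congrArg dot)
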